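/- Let k ≥ 1 be a fixed integer. Then almost surely κ₃(G(n, p(n))) ≤ k − 1, where p(n) = (1/2)·(log n + (k+1)·log log n − log log log n)/n. -/

import Mathlib

open Filter Asymptotics
open scoped Classical

noncomputable section

/-- The number of edges of a simple graph on a finite vertex type. -/
def edgeCount {V : Type*} [Fintype V] (G : SimpleGraph V) : ℕ :=
  G.edgeFinset.card

/-- Probability in the Erdős–Rényi model `G(n,p)` of a set `A` of graphs on `Fin n`:
each of the `n.choose 2` possible edges is present independently with probability `p`. -/
def gnpProb (n : ℕ) (p : ℝ) (A : Set (SimpleGraph (Fin n))) : ℝ :=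
  ∑ G ∈ Finset.univ.filter (fun G => G ∈ A),
    p ^ edgeCount G * (1 - p) ^ (n.choose 2 - edgeCount G)

/-- Probability in the uniform model `G(n,M)` of a set `A` of graphs on `Fin n`:
all graphs with exactly `M` edges are equally likely. -/
def gnmProb (n M : ℕ) (A : Set (SimpleGraph (Fin n))) : ℝ :=
  ((Finset.univ.filter (fun G : SimpleGraph (Fin n) => edgeCount G = M ∧ G ∈ A)).card : ℝ) /
    ((Finset.univ.filter (fun G : SimpleGraph (Fin n) => edgeCount G = M)).card : ℝ)

/-- `κ(S)`: the largest number of internally disjoint trees connecting `S`, i.e. trees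
`T₁, …, T_k` of `G` with `S ⊆ V(Tᵢ)`, `V(Tᵢ) ∩ V(Tⱼ) = S` and `E(Tᵢ) ∩ E(Tⱼ) = ∅`
for `i ≠ j`. -/
def kappaSet {V : Type*} (G : SimpleGraph V) (S : Set V) : ℕ :=
  sSup {k | ∃ T : Fin k → G.Subgraph,
    (∀ i, S ⊆ (T i).verts ∧ ((T i).coe).IsTree) ∧
    (∀ i j, i ≠ j → (T i).verts ∩ (T j).verts = S ∧
      (T i).edgeSet ∩ (T j).edgeSet = ∅)}

/-- `λ(S)`: the largest number of pairwise edge-disjoint trees of `G` each containing `S`. -/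
def lambdaSet {V : Type*} (G : SimpleGraph V) (S : Set V) : ℕ :=
  sSup {k | ∃ T : Fin k → G.Subgraph,
    (∀ i, S ⊆ (T i).verts ∧ ((T i).coe).IsTree) ∧
    (∀ i j, i ≠ j → (T i).edgeSet ∩ (T j).edgeSet = ∅)}

/-- The generalized `r`-connectivity `κ_r(G)`: the minimum of `κ(S)` over `r`-subsets `S`,
and `0` if `G` is disconnected. -/
def genKappa {V : Type*} [Fintype V] (r : ℕ) (G : SimpleGraph V) : ℕ :=
  if G.Connected then
    sInf {k | ∃ S : Finset V, S.card = r ∧ kappaSet G ↑S = k}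
  else 0

/-- The generalized `r`-edge-connectivity `λ_r(G)`: the minimum of `λ(S)` over
`r`-subsets `S`, and `0` if `G` is disconnected. -/
def genLambda {V : Type*} [Fintype V] (r : ℕ) (G : SimpleGraph V) : ℕ :=
  if G.Connected then
    sInf {k | ∃ S : Finset V, S.card = r ∧ lambdaSet G ↑S = k}
  else 0

/-- The vertex connectivity `κ(G)`: the largest `k` such that `G` is `k`-connected,
i.e. `k < |V|` and the removal of fewer than `k` vertices leaves a connected graph. -/
def vertexConnectivity {V : Type*} [Fintype V] (G : SimpleGraph V) : ℕ :=
  sSup {k | k < Fintype.card V ∧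
    ∀ S : Finset V, S.card < k → (G.induce ((↑S : Set V)ᶜ)).Connected}

/-- The edge connectivity `λ(G)`: the largest `k` such that removing fewer than `k`
edges always leaves a connected graph. -/
def edgeConnectivity {V : Type*} [Fintype V] (G : SimpleGraph V) : ℕ :=
  sSup {k | ∀ F : Finset (Sym2 V), F.card < k → (G.deleteEdges ↑F).Connected}

/-- The minimum degree `δ(G)`. -/
def minDeg {V : Type*} [Fintype V] (G : SimpleGraph V) : ℕ :=
  G.minDegree

/-- The number of children of `v` in the graph `H` viewed as rooted at `r`:
neighbours of `v` lying one step further from the root. -/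
def childCount {W : Type*} (H : SimpleGraph W) (r v : W) : ℕ :=
  {w | H.Adj v w ∧ H.dist r w = H.dist r v + 1}.ncard

/-- The depth of the graph `H` viewed as rooted at `r`: the largest distance from `r`. -/
def rootedDepth {W : Type*} (H : SimpleGraph W) (r : W) : ℕ :=
  sSup (Set.range (H.dist r))

/-- `T` is a subtree of `G` rooted at `r`, of depth `d`, in which every non-leaf
vertex has exactly `t` children (a `t`-ary tree of depth `d`). -/
def IsAryTreeOfDepth {V : Type*} {G : SimpleGraph V} (T : G.Subgraph) (r : V)
    (t d : ℕ) : Prop :=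
  ∃ hr : r ∈ T.verts,
    T.coe.IsTree ∧ rootedDepth T.coe ⟨r, hr⟩ = d ∧
      ∀ v : T.verts, childCount T.coe ⟨r, hr⟩ v = 0 ∨ childCount T.coe ⟨r, hr⟩ v = t

end

noncomputable section RandomGraph

variable {n : ℕ} {p : ℝ}

/-- The probability of a single graph in `G(n,p)`. -/
def gnpWeight (p : ℝ) (G : SimpleGraph (Fin n)) : ℝ :=
  p ^ edgeCount G * (1 - p) ^ (n.choose 2 - edgeCount G)

lemma gnpWeight_nonneg (hp0 : 0 ≤ p) (hp1 : p ≤ 1) (G : SimpleGraph (Fin n)) :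
    0 ≤ gnpWeight p G :=
  mul_nonneg (pow_nonneg hp0 _) (pow_nonneg (sub_nonneg.2 hp1) _)

lemma gnpProb_eq_sum_ite (A : Set (SimpleGraph (Fin n))) :
    gnpProb n p A = ∑ G, if G ∈ A then gnpWeight p G else 0 := by
  rw [gnpProb, Finset.sum_filter]
  rfl

lemma gnpProb_mono (hp0 : 0 ≤ p) (hp1 : p ≤ 1) {A B : Set (SimpleGraph (Fin n))} (h : A ⊆ B) :
    gnpProb n p A ≤ gnpProb n p B := by
  refine Finset.sum_le_sum_of_subset_of_nonneg ?_ fun G _ _ => gnpWeight_nonneg hp0 hp1 G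
  exact Finset.monotone_filter_right _ fun G _ hG => h hG

lemma edgeFinset_eq_of_eq_fromEdgeSet {s : Finset (Sym2 (Fin n))}
    (hs : s ⊆ (⊤ : SimpleGraph (Fin n)).edgeFinset) {G : SimpleGraph (Fin n)}
    (hG : G = SimpleGraph.fromEdgeSet (s : Set (Sym2 (Fin n)))) : G.edgeFinset = s := by
  ext e
  rw [SimpleGraph.mem_edgeFinset, hG, SimpleGraph.edgeSet_fromEdgeSet]
  refine ⟨fun h => h.1, fun h => ⟨h, ?_⟩⟩
  simpa using hs h

/-- The probability that no edge of a given set `F` is present. -/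
lemma gnpProb_eq_pow_card {A : Set (SimpleGraph (Fin n))} {F : Finset (Sym2 (Fin n))}
    (hF : F ⊆ (⊤ : SimpleGraph (Fin n)).edgeFinset)
    (hA : ∀ G : SimpleGraph (Fin n), G ∈ A ↔ Disjoint G.edgeFinset F) :
    gnpProb n p A = (1 - p) ^ F.card := by
  have hcard : (⊤ : SimpleGraph (Fin n)).edgeFinset.card = n.choose 2 := by
    simpa using SimpleGraph.card_edgeFinset_top_eq_card_choose_two (V := Fin n)
  have hsd : ((⊤ : SimpleGraph (Fin n)).edgeFinset \ F).card + F.card = n.choose 2 := by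
    rw [Finset.card_sdiff_add_card_eq_card hF, hcard]
  have hsub : ∀ G ∈ Finset.univ.filter (fun G => G ∈ A),
      G.edgeFinset ⊆ (⊤ : SimpleGraph (Fin n)).edgeFinset \ F := by
    intro G hG
    rw [Finset.subset_sdiff]
    exact ⟨SimpleGraph.edgeFinset_mono le_top, (hA G).1 (Finset.mem_filter.1 hG).2⟩
  calc gnpProb n p A
      = ∑ s ∈ ((⊤ : SimpleGraph (Fin n)).edgeFinset \ F).powerset,
          p ^ s.card * (1 - p) ^ (((⊤ : SimpleGraph (Fin n)).edgeFinset \ F).card - s.card) *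
            (1 - p) ^ F.card := by
        refine Finset.sum_bij' (fun G _ => G.edgeFinset)
          (fun s _ => SimpleGraph.fromEdgeSet (s : Set (Sym2 (Fin n)))) ?_ ?_ ?_ ?_ ?_
        · exact fun G hG => Finset.mem_powerset.2 (hsub G hG)
        · intro s hs
          rw [Finset.mem_powerset, Finset.subset_sdiff] at hs
          refine Finset.mem_filter.2 ⟨Finset.mem_univ _, (hA _).2 ?_⟩
          rw [edgeFinset_eq_of_eq_fromEdgeSet hs.1 rfl]
          exact hs.2
        · intro G _
          simp
        · intro s hs
          rw [Finset.mem_powerset, Finset.subset_sdiff] at hs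
          exact edgeFinset_eq_of_eq_fromEdgeSet hs.1 rfl
        · intro G hG
          have hle := Finset.card_le_card (hsub G hG)
          rw [mul_assoc, ← pow_add]
          unfold edgeCount
          congr 2
          omega
    _ = (1 - p) ^ F.card := by
        rw [← Finset.sum_mul, Finset.sum_pow_mul_eq_add_pow]
        simp

lemma gnpProb_univ : gnpProb n p Set.univ = 1 := by
  simpa using gnpProb_eq_pow_card (p := p) (A := Set.univ)
    (Finset.empty_subset (⊤ : SimpleGraph (Fin n)).edgeFinset) (by simp)

lemma sum_gnpWeight : ∑ G : SimpleGraph (Fin n), gnpWeight p G = 1 := by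
  simpa [gnpProb_eq_sum_ite] using gnpProb_univ (n := n) (p := p)

lemma gnpProb_le_one (hp0 : 0 ≤ p) (hp1 : p ≤ 1) (A : Set (SimpleGraph (Fin n))) :
    gnpProb n p A ≤ 1 :=
  (gnpProb_mono hp0 hp1 (Set.subset_univ A)).trans_eq gnpProb_univ

lemma gnpProb_add_compl (A : Set (SimpleGraph (Fin n))) :
    gnpProb n p A + gnpProb n p Aᶜ = 1 := by
  rw [gnpProb_eq_sum_ite, gnpProb_eq_sum_ite, ← Finset.sum_add_distrib, ← sum_gnpWeight (n := n) (p := p)]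
  refine Finset.sum_congr rfl fun G _ => ?_
  by_cases h : G ∈ A <;> simp [h]

lemma disjoint_incidenceFinset_top_iff_isIsolated (G : SimpleGraph (Fin n)) (v : Fin n) :
    Disjoint G.edgeFinset ((⊤ : SimpleGraph (Fin n)).incidenceFinset v) ↔ G.IsIsolated v := by
  rw [Finset.disjoint_left]
  constructor
  · intro h w hvw
    refine h (SimpleGraph.mem_edgeFinset.2 ((SimpleGraph.mem_edgeSet G).2 hvw)) ?_
    rw [SimpleGraph.mem_incidenceFinset]
    exact ⟨hvw.ne, Sym2.mem_mk_left v w⟩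
  · intro h e he hv
    rw [SimpleGraph.mem_incidenceFinset] at hv
    obtain ⟨w, rfl⟩ := Sym2.mem_iff_exists.1 hv.2
    exact h w (SimpleGraph.mem_edgeFinset.1 he)

lemma gnpProb_isIsolated (v : Fin n) :
    gnpProb n p {G | G.IsIsolated v} = (1 - p) ^ (n - 1) := by
  rw [gnpProb_eq_pow_card (A := {G | G.IsIsolated v})
      (SimpleGraph.incidenceFinset_subset (⊤ : SimpleGraph (Fin n)) v)
      fun G => (disjoint_incidenceFinset_top_iff_isIsolated G v).symm,
    SimpleGraph.card_incidenceFinset_eq_degree, SimpleGraph.complete_graph_degree,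
    Fintype.card_fin]

lemma gnpProb_isIsolated_and {u v : Fin n} (huv : u ≠ v) :
    gnpProb n p {G | G.IsIsolated u ∧ G.IsIsolated v} = (1 - p) ^ (2 * (n - 1) - 1) := by
  have hinter : (⊤ : SimpleGraph (Fin n)).incidenceFinset u ∩
      (⊤ : SimpleGraph (Fin n)).incidenceFinset v = {s(u, v)} := by
    ext e
    have := Set.ext_iff.1 (SimpleGraph.incidenceSet_inter_incidenceSet_of_adj
      (G := (⊤ : SimpleGraph (Fin n))) (a := u) (b := v) huv) e
    simpa [SimpleGraph.mem_incidenceFinset] using this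
  rw [gnpProb_eq_pow_card (A := {G | G.IsIsolated u ∧ G.IsIsolated v})
      (Finset.union_subset (SimpleGraph.incidenceFinset_subset (⊤ : SimpleGraph (Fin n)) u)
        (SimpleGraph.incidenceFinset_subset (⊤ : SimpleGraph (Fin n)) v))
      fun G => ((Finset.disjoint_union_right.trans
        (and_congr (disjoint_incidenceFinset_top_iff_isIsolated G u)
          (disjoint_incidenceFinset_top_iff_isIsolated G v))).symm),
    Finset.card_union, hinter, SimpleGraph.card_incidenceFinset_eq_degree,
    SimpleGraph.card_incidenceFinset_eq_degree, SimpleGraph.complete_graph_degree,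
    SimpleGraph.complete_graph_degree, Fintype.card_fin, Finset.card_singleton, two_mul]

/-- The number of isolated vertices, as a real number. -/
def isolatedCount (G : SimpleGraph (Fin n)) : ℝ :=
  ∑ v, if G.IsIsolated v then 1 else 0

lemma sum_gnpWeight_mul_isolatedCount :
    ∑ G : SimpleGraph (Fin n), gnpWeight p G * isolatedCount G = n * (1 - p) ^ (n - 1) := by
  simp_rw [isolatedCount, Finset.mul_sum]
  rw [Finset.sum_comm]
  have (v : Fin n) : ∑ G : SimpleGraph (Fin n), gnpWeight p G * (if G.IsIsolated v then 1 else 0)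
      = (1 - p) ^ (n - 1) := by
    rw [← gnpProb_isIsolated v, gnpProb_eq_sum_ite]
    simp
  rw [Finset.sum_congr rfl fun v _ => this v]
  simp

lemma sum_gnpWeight_mul_isolatedCount_sq_le (hp1 : p < 1) :
    ∑ G : SimpleGraph (Fin n), gnpWeight p G * isolatedCount G ^ 2 ≤
      n * (1 - p) ^ (n - 1) + n ^ 2 * (1 - p) ^ (2 * (n - 1) - 1) := by
  have key (u v : Fin n) : ∑ G : SimpleGraph (Fin n), gnpWeight p G *
      ((if G.IsIsolated u then 1 else 0) * (if G.IsIsolated v then 1 else 0)) ≤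
      (if u = v then (1 - p) ^ (n - 1) else 0) + (1 - p) ^ (2 * (n - 1) - 1) := by
    have hq : (0 : ℝ) ≤ (1 - p) ^ (2 * (n - 1) - 1) := pow_nonneg (sub_pos.2 hp1).le _
    by_cases huv : u = v
    · subst huv
      rw [if_pos rfl, ← gnpProb_isIsolated u, gnpProb_eq_sum_ite]
      refine le_add_of_le_of_nonneg (Finset.sum_le_sum fun G _ => ?_) hq
      by_cases h : G.IsIsolated u <;> simp [h]
    · rw [if_neg huv, zero_add, ← gnpProb_isIsolated_and huv, gnpProb_eq_sum_ite]
      refine Finset.sum_le_sum fun G _ => ?_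
      by_cases h : G.IsIsolated u <;> by_cases h' : G.IsIsolated v <;> simp [h, h']
  calc ∑ G : SimpleGraph (Fin n), gnpWeight p G * isolatedCount G ^ 2
      = ∑ u : Fin n, ∑ v : Fin n, ∑ G : SimpleGraph (Fin n), gnpWeight p G *
          ((if G.IsIsolated u then 1 else 0) * (if G.IsIsolated v then 1 else 0)) := by
        simp_rw [isolatedCount, sq, Finset.sum_mul_sum, Finset.mul_sum]
        rw [Finset.sum_comm]
        exact Finset.sum_congr rfl fun u _ => Finset.sum_comm
    _ ≤ ∑ u : Fin n, ∑ v : Fin n,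
          ((if u = v then (1 - p) ^ (n - 1) else 0) + (1 - p) ^ (2 * (n - 1) - 1)) :=
        Finset.sum_le_sum fun u _ => Finset.sum_le_sum fun v _ => key u v
    _ = n * (1 - p) ^ (n - 1) + n ^ 2 * (1 - p) ^ (2 * (n - 1) - 1) := by
        simp [Finset.sum_add_distrib, sq, mul_assoc]

/-- Chebyshev's inequality for the number of isolated vertices. -/
lemma gnpProb_no_isolated_mul_le (hp0 : 0 ≤ p) (hp1 : p < 1) :
    gnpProb n p {G | ∃ v, G.IsIsolated v}ᶜ * (n * (1 - p) ^ (n - 1)) ^ 2 ≤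
      n * (1 - p) ^ (n - 1) + n ^ 2 * (1 - p) ^ (2 * (n - 1) - 1) -
        (n * (1 - p) ^ (n - 1)) ^ 2 := by
  set μ : ℝ := n * (1 - p) ^ (n - 1) with hμ
  have hvar : ∑ G : SimpleGraph (Fin n), gnpWeight p G * (isolatedCount G - μ) ^ 2 =
      ∑ G : SimpleGraph (Fin n), gnpWeight p G * isolatedCount G ^ 2 - μ ^ 2 := by
    have h1 := sum_gnpWeight_mul_isolatedCount (n := n) (p := p)
    have h0 := sum_gnpWeight (n := n) (p := p)
    rw [← hμ] at h1
    calc _ = ∑ G : SimpleGraph (Fin n), (gnpWeight p G * isolatedCount G ^ 2 -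
            2 * μ * (gnpWeight p G * isolatedCount G) + μ ^ 2 * gnpWeight p G) :=
          Finset.sum_congr rfl fun G _ => by ring
      _ = _ := by
          rw [Finset.sum_add_distrib, Finset.sum_sub_distrib, ← Finset.mul_sum, ← Finset.mul_sum,
            h1, h0]
          ring
  have hle : gnpProb n p {G | ∃ v, G.IsIsolated v}ᶜ * μ ^ 2 ≤
      ∑ G : SimpleGraph (Fin n), gnpWeight p G * (isolatedCount G - μ) ^ 2 := by
    rw [gnpProb_eq_sum_ite, Finset.sum_mul]
    refine Finset.sum_le_sum fun G _ => ?_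
    have hw := gnpWeight_nonneg hp0 hp1.le G
    by_cases h : ∃ v, G.IsIsolated v
    · rw [if_neg (fun h' : G ∈ {G : SimpleGraph (Fin n) | ∃ v, G.IsIsolated v}ᶜ => h' h), zero_mul]
      positivity
    · rw [if_pos (show G ∈ {G : SimpleGraph (Fin n) | ∃ v, G.IsIsolated v}ᶜ from h)]
      push Not at h
      simp [isolatedCount, h]
  have := sum_gnpWeight_mul_isolatedCount_sq_le (n := n) hp1
  rw [← hμ] at this
  linarith

lemma le_gnpProb_exists_isIsolated (hn : 2 ≤ n) (hp0 : 0 ≤ p) (hp1 : p < 1) :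
    1 - (((n : ℝ) * (1 - p) ^ (n - 1))⁻¹ + ((1 - p)⁻¹ - 1)) ≤
      gnpProb n p {G | ∃ v, G.IsIsolated v} := by
  have hq : 0 < 1 - p := sub_pos.2 hp1
  have hn0 : (0 : ℝ) < n := by exact_mod_cast (by omega : 0 < n)
  have h := gnpProb_no_isolated_mul_le (n := n) hp0 hp1
  have hpow : (1 - p) ^ (2 * (n - 1) - 1) = ((1 - p) ^ (n - 1)) ^ 2 * (1 - p)⁻¹ := by
    rw [← pow_mul, eq_mul_inv_iff_mul_eq₀ hq.ne', ← pow_succ]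
    congr 1
    omega
  rw [hpow] at h
  have hμ : 0 < (n : ℝ) * (1 - p) ^ (n - 1) := by positivity
  have h2 : gnpProb n p {G | ∃ v, G.IsIsolated v}ᶜ ≤
      ((n : ℝ) * (1 - p) ^ (n - 1))⁻¹ + ((1 - p)⁻¹ - 1) := by
    refine le_of_mul_le_mul_right (h.trans_eq ?_) (pow_pos hμ 2)
    field_simp
    ring
  linarith [gnpProb_add_compl (n := n) (p := p) {G | ∃ v, G.IsIsolated v}]

/-- If the edge probability tends to `0` and the expected number of isolated vertices tends to
infinity, then almost surely there is an isolated vertex. -/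
lemma tendsto_gnpProb_exists_isIsolated {p : ℕ → ℝ} (hp0 : ∀ᶠ n in atTop, 0 ≤ p n)
    (hp : Tendsto p atTop (nhds 0))
    (hμ : Tendsto (fun n : ℕ => (n : ℝ) * (1 - p n) ^ (n - 1)) atTop atTop) :
    Tendsto (fun n => gnpProb n (p n) {G | ∃ v, G.IsIsolated v}) atTop (nhds 1) := by
  have hlow : Tendsto (fun n : ℕ =>
      1 - (((n : ℝ) * (1 - p n) ^ (n - 1))⁻¹ + ((1 - p n)⁻¹ - 1))) atTop (nhds 1) := by
    have h1 : Tendsto (fun n => (1 - p n)⁻¹) atTop (nhds (1 - 0)⁻¹) :=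
      (tendsto_const_nhds.sub hp).inv₀ (by norm_num)
    simpa using (hμ.inv_tendsto_atTop.add (h1.sub_const 1)).const_sub 1
  have hp1 : ∀ᶠ n in atTop, p n < 1 := hp.eventually_lt_const one_pos
  refine tendsto_of_tendsto_of_tendsto_of_le_of_le' hlow tendsto_const_nhds ?_ ?_
  · filter_upwards [hp0, hp1, eventually_ge_atTop 2] with n h0 h1 hn
    exact le_gnpProb_exists_isIsolated hn h0 h1
  · filter_upwards [hp0, hp1] with n h0 h1
    exact gnpProb_le_one h0 h1.le _

end RandomGraph

/-- If `0 ≤ n p(n) ≤ (5/8) log n` then the expected number of isolated vertices tends to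
infinity. -/
lemma tendsto_expected_isolated_atTop {p : ℕ → ℝ} (hp0 : ∀ᶠ n in atTop, 0 ≤ p n)
    (hp : Tendsto p atTop (nhds 0)) (hlog : ∀ᶠ n : ℕ in atTop, n * p n ≤ 5 / 8 * Real.log n) :
    Tendsto (fun n : ℕ => (n : ℝ) * (1 - p n) ^ (n - 1)) atTop atTop := by
  have hlogtop : Tendsto (fun n : ℕ => Real.log n) atTop atTop :=
    Real.tendsto_log_atTop.comp tendsto_natCast_atTop_atTop
  refine tendsto_atTop_mono' _ ?_
    (Real.tendsto_exp_atTop.comp (hlogtop.const_mul_atTop (by norm_num : (0 : ℝ) < 1 / 4)))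
  filter_upwards [hp0, hlog, hp.eventually_lt_const (by norm_num : (0 : ℝ) < 1 / 6),
    eventually_ge_atTop 1] with n h0 hl h6 hn
  have hn0 : (0 : ℝ) < n := by exact_mod_cast hn
  have hq : 0 < 1 - p n := by linarith
  have hinv : (1 - p n)⁻¹ - 1 ≤ 6 / 5 * p n := by
    have : (1 - p n)⁻¹ ≤ 1 + 6 / 5 * p n := by
      rw [inv_le_iff_one_le_mul₀ hq]
      nlinarith
    linarith
  have hlogq := Real.one_sub_inv_le_log_of_pos hq
  have hbound : 1 / 4 * Real.log n ≤ Real.log n + n * Real.log (1 - p n) := by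
    have : (n : ℝ) * -(6 / 5 * p n) ≤ n * Real.log (1 - p n) :=
      mul_le_mul_of_nonneg_left (by linarith) hn0.le
    linarith
  calc Real.exp (1 / 4 * Real.log n) ≤ Real.exp (Real.log n + n * Real.log (1 - p n)) :=
        Real.exp_le_exp.2 hbound
    _ = n * (1 - p n) ^ n := by
        rw [Real.exp_add, Real.exp_log hn0, Real.exp_nat_mul, Real.exp_log hq]
    _ ≤ n * (1 - p n) ^ (n - 1) :=
        mul_le_mul_of_nonneg_left
          (pow_le_pow_of_le_one hq.le (by linarith) (Nat.sub_le n 1)) hn0.le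

lemma eventually_half_log_bounds (c : ℝ) (hc : 1 ≤ c) :
    ∀ᶠ n : ℕ in atTop,
      0 ≤ 1 / 2 * (Real.log n + c * Real.log (Real.log n) -
        Real.log (Real.log (Real.log n))) ∧
      1 / 2 * (Real.log n + c * Real.log (Real.log n) -
        Real.log (Real.log (Real.log n))) ≤ 5 / 8 * Real.log n := by
  have hlogtop : Tendsto (fun n : ℕ => Real.log n) atTop atTop :=
    Real.tendsto_log_atTop.comp tendsto_natCast_atTop_atTop
  have hloglog := Real.tendsto_log_atTop.comp hlogtop
  have hlogloglog := Real.tendsto_log_atTop.comp hloglog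
  have ho := (Real.isLittleO_log_id_atTop.comp_tendsto hlogtop).bound
    (by positivity : (0 : ℝ) < 1 / (4 * c))
  filter_upwards [ho, hlogtop.eventually_ge_atTop 0, hloglog.eventually_ge_atTop 1,
    hlogloglog.eventually_ge_atTop 0] with n h h1 h2 h3
  simp only [Function.comp_apply, id, Real.norm_eq_abs] at h h2 h3
  rw [abs_of_nonneg (by linarith), abs_of_nonneg h1] at h
  have h4 : c * Real.log (Real.log n) ≤ 1 / 4 * Real.log n := by
    calc c * Real.log (Real.log n) ≤ c * (1 / (4 * c) * Real.log n) := by gcongr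
      _ = 1 / 4 * Real.log n := by field_simp
  have h5 := Real.log_le_self (by linarith : 0 ≤ Real.log (Real.log n))
  have h6 : Real.log (Real.log n) ≤ c * Real.log (Real.log n) :=
    le_mul_of_one_le_left (by linarith) hc
  constructor <;> linarith

lemma genKappa_eq_zero_of_isIsolated {V : Type*} [Fintype V] [Nontrivial V] {G : SimpleGraph V}
    {v : V} (hv : G.IsIsolated v) (r : ℕ) : genKappa r G = 0 :=
  if_neg fun h => h.preconnected.not_isIsolated v hv

/-- Almost surely `κ₃(G(n, p(n))) ≤ k − 1` for
`p(n) = (1/2)(log n + (k+1) log log n − log log log n)/n`. -/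
theorem genKappa_three_le_as (k : ℕ) (hk : 1 ≤ k) :
    Tendsto (fun n : ℕ =>
      gnpProb n ((1 / 2) * ((Real.log n + ((k : ℝ) + 1) * Real.log (Real.log n) -
          Real.log (Real.log (Real.log n))) / n))
        {G : SimpleGraph (Fin n) | genKappa 3 G ≤ k - 1})
      atTop (nhds 1) := by
  set p : ℕ → ℝ := fun n => (1 / 2) * ((Real.log n + ((k : ℝ) + 1) * Real.log (Real.log n) -
    Real.log (Real.log (Real.log n))) / n) with hpdef
  have hb := eventually_half_log_bounds ((k : ℝ) + 1) (by linarith [k.cast_nonneg (α := ℝ)])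
  have hmul : ∀ᶠ n : ℕ in atTop, 0 ≤ p n ∧ n * p n ≤ 5 / 8 * Real.log n := by
    filter_upwards [hb, eventually_ge_atTop 1] with n h hn
    have hn0 : (0 : ℝ) < n := by exact_mod_cast hn
    have hnp : n * p n = 1 / 2 * (Real.log n + ((k : ℝ) + 1) * Real.log (Real.log n) -
        Real.log (Real.log (Real.log n))) := by
      simp only [hpdef]
      field_simp
    rw [← hnp] at h
    exact ⟨nonneg_of_mul_nonneg_right h.1 hn0, h.2⟩
  have hp0 := hmul.mono fun n h => h.1
  have hlog := hmul.mono fun n h => h.2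
  have hp : Tendsto p atTop (nhds 0) := by
    have hlim : Tendsto (fun n : ℕ => 5 / 8 * (Real.log n / n)) atTop (nhds 0) := by
      simpa using ((Real.isLittleO_log_id_atTop.tendsto_div_nhds_zero).comp
        tendsto_natCast_atTop_atTop).const_mul (5 / 8 : ℝ)
    refine tendsto_of_tendsto_of_tendsto_of_le_of_le' tendsto_const_nhds hlim hp0 ?_
    filter_upwards [hlog, eventually_ge_atTop 1] with n h hn
    have hn0 : (0 : ℝ) < n := by exact_mod_cast hn
    rw [← mul_div_assoc, le_div_iff₀ hn0]
    linarith
  have hp1 : ∀ᶠ n in atTop, p n < 1 := hp.eventually_lt_const one_pos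
  refine tendsto_of_tendsto_of_tendsto_of_le_of_le' (tendsto_gnpProb_exists_isIsolated hp0 hp
    (tendsto_expected_isolated_atTop hp0 hp hlog)) tendsto_const_nhds ?_ ?_
  · filter_upwards [hp0, hp1, eventually_ge_atTop 2] with n h0 h1 hn
    refine gnpProb_mono h0 h1.le fun G ⟨v, hv⟩ => ?_
    have : Nontrivial (Fin n) := Fin.nontrivial_iff_two_le.2 hn
    rw [Set.mem_ofPred_eq, genKappa_eq_zero_of_isIsolated hv]
    exact Nat.zero_le _
  · filter_upwards [hp0, hp1] with n h0 h1
    exact gnpProb_le_one h0 h1.le _
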